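/- Fix s_0 > 0 and a compact set K ⊂ ℂ∖[−a,0]. There exist constants C > 0 and n_0 ≥ 1 such that for all integers n ≥ n_0, all s ≥ −s_0 and all z ∈ K, every entry of the 2×2 matrix M(z)·G_n(z|s)^{−1} − I − n^{−1/3}·( q_0^{(1)}(s)·σ_3 − q^{(1)}(z|s)·M(z) σ_3 M(z)^{−1} ) has absolute value at most C n^{−2/3}. -/

import Mathlib

open MeasureTheory
theorem log1p_bd (y : ℝ) : 0 ≤ Real.log (1 + Real.exp y) ∧ Real.log (1 + Real.exp y) ≤ Real.exp y := by
  have := Real.exp_pos y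
  refine ⟨Real.log_nonneg (by linarith), ?_⟩
  have := Real.log_le_sub_one_of_pos (show 0 < 1 + Real.exp y by linarith)
  linarith

theorem log1p_sub (y1 y2 : ℝ) (h : y2 ≤ y1) :
    0 ≤ Real.log (1 + Real.exp y1) - Real.log (1 + Real.exp y2) ∧
    Real.log (1 + Real.exp y1) - Real.log (1 + Real.exp y2) ≤ (y1 - y2) * Real.exp y1 := by
  have h1 := Real.exp_pos y1
  have h2 := Real.exp_pos y2
  have h12 := Real.exp_le_exp.2 h
  constructor
  · have := Real.log_le_log (show 0 < 1 + Real.exp y2 by linarith) (show 1 + Real.exp y2 ≤ 1 + Real.exp y1 by linarith)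
    linarith
  · rw [← Real.log_div (by positivity) (by positivity)]
    have h3 := Real.log_le_sub_one_of_pos (show 0 < (1 + Real.exp y1) / (1 + Real.exp y2) by positivity)
    have h4 : (1 + Real.exp y1) / (1 + Real.exp y2) - 1 ≤ Real.exp y1 - Real.exp y2 := by
      rw [div_sub_one (by positivity), div_le_iff₀ (by positivity)]
      nlinarith
    have h5 : Real.exp y2 = Real.exp y1 * Real.exp (y2 - y1) := by rw [← Real.exp_add]; congr 1; ring
    have h6 := Real.add_one_le_exp (y2 - y1)
    nlinarith

theorem log1p_abs (y1 y2 Y : ℝ) (h1 : y1 ≤ Y) (h2 : y2 ≤ Y) :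
    |Real.log (1 + Real.exp y1) - Real.log (1 + Real.exp y2)| ≤ |y1 - y2| * Real.exp Y := by
  rcases le_total y2 y1 with h | h
  · obtain ⟨a, b⟩ := log1p_sub y1 y2 h
    rw [abs_of_nonneg a, abs_of_nonneg (by linarith)]
    exact b.trans (mul_le_mul_of_nonneg_left (Real.exp_le_exp.2 h1) (by linarith))
  · obtain ⟨a, b⟩ := log1p_sub y2 y1 h
    rw [abs_sub_comm, abs_sub_comm y1, abs_of_nonneg a, abs_of_nonneg (by linarith)]
    exact b.trans (mul_le_mul_of_nonneg_left (Real.exp_le_exp.2 h2) (by linarith))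

theorem Q_bounds (a t : ℝ) (ha : 0 < a) (ht : 0 < t)
    (Q : ℝ → ℝ)
    (hQcont : ContinuousOn Q (Set.Icc (-a) 0))
    (hQpos : ∀ x ∈ Set.Ico (-a) (0 : ℝ), 0 < Q x)
    (hQ0 : Q 0 = 0)
    (hQsm : ∃ U : Set ℝ, IsOpen U ∧ (0 : ℝ) ∈ U ∧ ContDiffOn ℝ (⊤ : ℕ∞) Q U)
    (hQder : deriv Q 0 = -t) :
    ∃ A > 0, ∃ c > 0, c ≤ t ∧ ∀ x ∈ Set.Ioo (-a) (0:ℝ), c * (-x) ≤ Q x ∧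
      |Q x + t * x| ≤ A * x ^ 2 := by
  obtain ⟨U, hU, h0U, hQU⟩ := hQsm
  have hd : ContDiffOn ℝ (1 : ℕ∞) (deriv Q) U := by
    refine ((contDiffOn_succ_iff_deriv_of_isOpen (n := 1) hU).1 (hQU.of_le ?_)).2.2
    norm_cast
  have hdU : DifferentiableOn ℝ Q U := hQU.differentiableOn (by simp)
  have hd0 : DifferentiableAt ℝ (deriv Q) 0 :=
    (hd.differentiableOn (by simp)).differentiableAt (hU.mem_nhds h0U)
  have hO := hd0.isBigO_sub
  obtain ⟨A1, hA1p, hA1⟩ := hO.exists_pos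
  rw [Asymptotics.IsBigOWith] at hA1
  obtain ⟨δ1, hδ1, hδ⟩ := Metric.eventually_nhds_iff_ball.1 (hA1.and (hU.mem_nhds h0U))
  have key : ∀ x ∈ Metric.ball (0:ℝ) δ1, |Q x + t * x| ≤ A1 * x ^ 2 := by
    intro x hx
    have hx' : |x| < δ1 := by simpa using hx
    have hsub : ∀ y ∈ Set.uIcc 0 x, |y| ≤ |x| ∧ y ∈ Metric.ball (0:ℝ) δ1 := by
      intro y hy
      have : |y| ≤ |x| := by
        have := Set.abs_sub_left_of_mem_uIcc hy
        simpa using this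
      exact ⟨this, by simpa using this.trans_lt hx'⟩
    have := (convex_uIcc (0:ℝ) x).norm_image_sub_le_of_norm_hasDerivWithin_le (f := fun y => Q y + t * y) (f' := fun y => deriv Q y + t) (C := A1 * |x|) (x := 0) (y := x) ?_ ?_ Set.left_mem_uIcc Set.right_mem_uIcc
    · simp only [hQ0, Real.norm_eq_abs] at this
      calc _ ≤ _ := by simpa using this
        _ = A1 * (|x| * |x|) := by ring
        _ = _ := by rw [abs_mul_abs_self]; ring
    · intro y hy
      have h1 := ((hdU.differentiableAt (hU.mem_nhds (hδ y (hsub y hy).2).2)).hasDerivAt).add ((hasDerivAt_id y).const_mul t)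
      simp only [mul_one] at h1
      exact h1.hasDerivWithinAt
    · intro y hy
      have h1 := (hδ y (hsub y hy).2).1
      rw [hQder] at h1
      simp only [sub_neg_eq_add, sub_zero, Real.norm_eq_abs] at h1 ⊢
      exact h1.trans (mul_le_mul_of_nonneg_left (hsub y hy).1 hA1p.le)
  set δ := min (min (δ1 / 2) a) (t / (2 * A1)) with hδdef
  have hδp : 0 < δ := by positivity
  have e1 : δ ≤ δ1 / 2 := (min_le_left _ _).trans (min_le_left _ _)
  have e2 : δ ≤ a := (min_le_left _ _).trans (min_le_right _ _)
  have e3 : δ ≤ t / (2 * A1) := min_le_right _ _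
  have e4 : δ * A1 ≤ t / 2 := by
    rw [le_div_iff₀ (by positivity)] at e3; linarith
  have hsubI : Set.Icc (-a) (-δ) ⊆ Set.Icc (-a) 0 := Set.Icc_subset_Icc_right (by linarith)
  obtain ⟨xm, hxm, hmin⟩ := isCompact_Icc.exists_isMinOn (Set.nonempty_Icc.2 (by linarith : -a ≤ -δ)) (hQcont.mono hsubI)
  obtain ⟨B, hB⟩ := isCompact_Icc.exists_bound_of_continuousOn (hQcont)
  have hm : 0 < Q xm := hQpos xm ⟨hxm.1, by linarith [hxm.2]⟩
  have hB0 : 0 ≤ B := (norm_nonneg _).trans (hB 0 ⟨by linarith, le_refl _⟩)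
  refine ⟨A1 + (B + t * a) / δ ^ 2, by positivity, min (t / 2) (Q xm / a), by positivity, (min_le_left _ _).trans (by linarith), ?_⟩
  intro x hx
  rcases lt_or_ge (-δ) x with h | h
  · have hk := key x (by simp [abs_of_neg hx.2]; linarith)
    have : A1 * x^2 ≤ t/2 * (-x) := by
      have hx2 := hx.2
      calc A1 * x^2 = A1 * (-x) * (-x) := by ring
        _ ≤ A1 * δ * (-x) := by
          have : 0 ≤ -x := by linarith
          gcongr
          linarith
        _ ≤ t/2 * (-x) := by
          have : 0 ≤ -x := by linarith
          gcongr
          linarith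
    constructor
    · have h1 := neg_abs_le (Q x + t * x)
      have h2 : min (t / 2) (Q xm / a) * (-x) ≤ t/2 * (-x) := by
        gcongr
        · linarith [hx.2]
        · exact min_le_left _ _
      linarith
    · refine hk.trans ?_
      gcongr
      have : 0 ≤ (B + t * a) / δ ^ 2 := by positivity
      linarith
  · constructor
    · have h1 : Q xm ≤ Q x := hmin ⟨hx.1.le, h⟩
      have h2 : min (t / 2) (Q xm / a) * (-x) ≤ Q xm / a * a := by
        gcongr
        · linarith [hx.2]
        · exact min_le_right _ _
        · linarith [hx.1]
      rw [div_mul_cancel₀ _ ha.ne'] at h2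
      linarith
    · have h1 : |Q x| ≤ B := hB x ⟨hx.1.le, hx.2.le⟩
      have h2 : |t * x| ≤ t * a := by
        rw [abs_mul, abs_of_pos ht, abs_of_neg hx.2]; gcongr; linarith [hx.1]
      have h3 : δ^2 ≤ x^2 := by nlinarith
      calc |Q x + t * x| ≤ B + t * a := (abs_add_le _ _).trans (by linarith)
        _ = (B + t * a) / δ ^ 2 * δ^2 := by field_simp
        _ ≤ (B + t * a) / δ ^ 2 * x^2 := by gcongr
        _ ≤ _ := by gcongr; linarith

theorem S_preconn (a : ℝ) (ha : 0 < a) : IsPreconnected {z : ℂ | ¬(z.im = 0 ∧ -a ≤ z.re ∧ z.re ≤ 0)} := by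
  have h1 : IsPreconnected Complex.slitPlane := 
    (Complex.starConvex_one_slitPlane.isPathConnected Complex.one_mem_slitPlane).isConnected.isPreconnected
  have h2 : IsPreconnected ((fun z : ℂ => -z - (a:ℂ)) '' Complex.slitPlane) :=
    h1.image _ (by fun_prop)
  have h3 := IsPreconnected.union (Complex.I) (s := Complex.slitPlane) (t := ((fun z : ℂ => -z - (a:ℂ)) '' Complex.slitPlane)) (by simp [Complex.mem_slitPlane_iff]) ⟨-Complex.I - a, by simp [Complex.mem_slitPlane_iff], by ring⟩ h1 h2
  convert h3 using 1
  ext z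
  simp only [Set.mem_ofPred_eq, Set.mem_union, Set.mem_image]
  constructor
  · intro h
    by_cases hz : z ∈ Complex.slitPlane
    · exact Or.inl hz
    · right
      refine ⟨-z - a, ?_, by ring⟩
      rw [Complex.mem_slitPlane_iff] at hz ⊢
      push Not at hz
      left
      simp
      by_contra hh
      exact h ⟨hz.2, by linarith, hz.1⟩
  · rintro (h | ⟨w, hw, rfl⟩) ⟨h1, h2, h3⟩
    · rw [Complex.mem_slitPlane_iff] at h
      rcases h with h | h
      · linarith
      · exact h h1
    · rw [Complex.mem_slitPlane_iff] at hw
      simp at h1 h2 h3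
      rcases hw with h | h
      · linarith
      · exact h h1

theorem r_eq (a : ℝ) (ha : 0 < a) 
    (S : Set ℂ) (hS : S = {z : ℂ | ¬(z.im = 0 ∧ -a ≤ z.re ∧ z.re ≤ 0)})
    (r : ℂ → ℂ)
    (hr_an : DifferentiableOn ℂ r S)
    (hr_sq : ∀ z ∈ S, (r z) ^ 2 = (z + Complex.ofReal a) * z)
    (hr_pos : ∀ x : ℝ, 0 < x → (r (Complex.ofReal x)).im = 0 ∧ 0 < (r (Complex.ofReal x)).re)
    (mq : ℂ → ℂ)
    (hmq_an : DifferentiableOn ℂ mq S)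
    (hmq_pow : ∀ z ∈ S, (mq z) ^ 4 = z / (z + Complex.ofReal a))
    (hmq_pos : ∀ x : ℝ, 0 < x →
      (mq (Complex.ofReal x)).im = 0 ∧ 0 < (mq (Complex.ofReal x)).re) :
    ∀ z ∈ S, mq z ≠ 0 ∧ r z / z = 1 / (mq z)^2 := by
  have hz0 : ∀ z ∈ S, z ≠ 0 := by
    rintro z hz rfl
    rw [hS] at hz
    exact hz ⟨by simp, by simp [ha.le], by simp⟩
  have hza : ∀ z ∈ S, z + (a:ℂ) ≠ 0 := by
    intro z hz h
    have : z = ((-a : ℝ) : ℂ) := by push_cast; linear_combination h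
    rw [hS, this] at hz
    exact hz ⟨by simp, by simp, by simp [ha.le]⟩
  have hm0 : ∀ z ∈ S, mq z ≠ 0 := by
    intro z hz h
    have := hmq_pow z hz
    rw [h] at this
    exact div_ne_zero (hz0 z hz) (hza z hz) (by simpa using this.symm)
  have hpre : IsPreconnected S := hS ▸ S_preconn a ha
  have h1S : (1:ℂ) ∈ S := by
    rw [hS]; rintro ⟨_, _, h⟩; simp at h; linarith
  have heq : Set.EqOn (fun z => r z / z) (fun z => 1 / (mq z)^2) S := by
    refine hpre.eq_of_sq_eq ?_ ?_ ?_ ?_ h1S ?_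
    · exact hr_an.continuousOn.div continuousOn_id hz0
    · exact continuousOn_const.div (hmq_an.continuousOn.pow 2) (fun z hz => pow_ne_zero 2 (hm0 z hz))
    · intro z hz
      have := hr_sq z hz
      have h4 := hmq_pow z hz
      have := hz0 z hz
      have := hza z hz
      have := hm0 z hz
      simp only [Pi.pow_apply]
      rw [div_pow, hr_sq z hz, div_pow, one_pow, ← pow_mul, show 2*2 = 4 from rfl, h4]
      field_simp
    · intro z hz
      exact div_ne_zero one_ne_zero (pow_ne_zero 2 (hm0 z hz))
    · have h1 := hr_pos 1 one_pos
      have h2 := hmq_pos 1 one_pos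
      have s1 := hr_sq 1 h1S
      have s2 := hmq_pow 1 h1S
      simp only [Complex.ofReal_one] at h1 h2
      obtain ⟨ρ, hρ⟩ : ∃ ρ : ℝ, r 1 = ρ := ⟨(r 1).re, Complex.ext (by simp) (by simp [h1.1])⟩
      obtain ⟨μ, hμ⟩ : ∃ ρ : ℝ, mq 1 = ρ := ⟨(mq 1).re, Complex.ext (by simp) (by simp [h2.1])⟩
      simp only [hρ, hμ] at *
      norm_cast at s1 s2 h1 h2 ⊢
      have hp1 := h1.2
      have hp2 := h2.2
      have : (ρ * μ^2)^2 = 1 := by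
        rw [mul_pow, s1, ← pow_mul, show 2*2 = 4 from rfl, s2]; field_simp
      have h3 : ρ * μ^2 = 1 := by
        have : 0 < ρ * μ^2 := by positivity
        nlinarith
      field_simp
      linarith
  exact fun z hz => ⟨hm0 z hz, heq hz⟩

theorem exp2 (w : ℂ) (B : ℝ) (h : ‖w‖ ≤ B) : ‖Complex.exp w - 1 - w‖ ≤ ‖w‖^2 * Real.exp B := by
  have := Complex.norm_exp_sub_sum_le_norm_mul_exp w 2
  simp [Finset.sum_range_succ] at this
  calc _ = ‖Complex.exp w - (1 + w)‖ := by congr 1; ring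
    _ ≤ _ := this
    _ ≤ _ := by gcongr

/-- scalar expansion -/
theorem scal (B : ℝ) (hB : 0 < B) : ∃ C > 0, ∀ (ε : ℝ) (q q' p p' P d : ℂ), 0 ≤ ε → ε ≤ 1 → ‖P‖ ≤ B → ‖d‖ ≤ 1 →
    ‖q‖ ≤ B * ε → ‖p‖ ≤ B * ε → ‖q - q'‖ ≤ B * ε^2 → ‖p - p'‖ ≤ B * ε^2 →
    ‖((Complex.exp (-q) + Complex.exp q) / 2 * d + (Complex.exp (-q) - Complex.exp q) / 2 * P) * Complex.exp p
      - d - (p' * d - q' * P)‖ ≤ C * ε^2 := by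
  set D := B^2 * Real.exp B with hD
  refine ⟨(1 + B) * D * Real.exp B + D * (1 + B^2) + B^3 + B * (1 + B), by positivity, ?_⟩
  intro ε q q' p p' P d h0 h1 hP hd hq hp hqq hpp
  have hBe : B * ε ≤ B := by nlinarith
  have bd : ∀ w : ℂ, ‖w‖ ≤ B * ε → ‖Complex.exp w - 1 - w‖ ≤ D * ε^2 := by
    intro w hw
    have := exp2 w B (hw.trans hBe)
    calc _ ≤ _ := this
      _ ≤ (B * ε)^2 * Real.exp B := by gcongr
      _ = _ := by rw [hD]; ring
  have b1 := bd q hq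
  have b2 := bd (-q) (by simpa using hq)
  have b3 := bd p hp
  set x := Complex.exp q - 1 - q
  set y := Complex.exp (-q) - 1 - (-q)
  set w := Complex.exp p - 1 - p
  have hR : ‖(x + y) / 2 * d + (y - x) / 2 * P‖ ≤ (1 + B) * (D * ε^2) := by
    have e1 : ‖(x+y)/2‖ ≤ D * ε^2 := by
      rw [norm_div]; have := norm_add_le x y; simp; linarith
    have e2 : ‖(y-x)/2‖ ≤ D * ε^2 := by
      rw [norm_div]; have := norm_sub_le y x; simp; linarith
    calc _ ≤ ‖(x + y) / 2 * d‖ + ‖(y - x) / 2 * P‖ := norm_add_le _ _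
      _ = ‖(x + y) / 2‖ * ‖d‖ + ‖(y - x) / 2‖ * ‖P‖ := by rw [norm_mul, norm_mul]
      _ ≤ (D * ε^2) * 1 + (D * ε^2) * B := by gcongr
      _ = _ := by ring
  have hE : ‖Complex.exp p‖ ≤ Real.exp B :=
    (Complex.norm_exp_le_exp_norm p).trans (Real.exp_le_exp.2 (hp.trans hBe))
  have id : ((Complex.exp (-q) + Complex.exp q) / 2 * d + (Complex.exp (-q) - Complex.exp q) / 2 * P) * Complex.exp p
      - d - (p' * d - q' * P) = ((x + y) / 2 * d + (y - x) / 2 * P) * Complex.exp p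
       + w * d - (w * q) * P - (p * q) * P + (p - p') * d - (q - q') * P := by
    simp only [x, y, w]; ring
  rw [id]
  have t1 : ‖((x + y) / 2 * d + (y - x) / 2 * P) * Complex.exp p‖ ≤ (1 + B) * (D * ε^2) * Real.exp B := by
    rw [norm_mul]; gcongr
  have t2 : ‖w * d‖ ≤ D * ε^2 * 1 := by rw [norm_mul]; gcongr
  have t3 : ‖(w * q) * P‖ ≤ (D * ε^2 * B) * B := by rw [norm_mul, norm_mul]; gcongr; exact hq.trans hBe
  have t4 : ‖(p * q) * P‖ ≤ ((B * ε) * (B * ε)) * B := by rw [norm_mul, norm_mul]; gcongr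
  have t5 : ‖(p - p') * d‖ ≤ B * ε^2 * 1 := by rw [norm_mul]; gcongr
  have t6 : ‖(q - q') * P‖ ≤ B * ε^2 * B := by rw [norm_mul]; gcongr
  have tt := (norm_sub_le (((x + y) / 2 * d + (y - x) / 2 * P) * Complex.exp p
       + w * d - (w * q) * P - (p * q) * P + (p - p') * d) ((q - q') * P))
  have tt2 := norm_add_le (((x + y) / 2 * d + (y - x) / 2 * P) * Complex.exp p
       + w * d - (w * q) * P - (p * q) * P) ((p - p') * d)
  have tt3 := norm_sub_le (((x + y) / 2 * d + (y - x) / 2 * P) * Complex.exp p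
       + w * d - (w * q) * P) ((p * q) * P)
  have tt4 := norm_sub_le (((x + y) / 2 * d + (y - x) / 2 * P) * Complex.exp p
       + w * d) ((w * q) * P)
  have tt5 := norm_add_le (((x + y) / 2 * d + (y - x) / 2 * P) * Complex.exp p) (w * d)
  have fin : (1 + B) * (D * ε^2) * Real.exp B + D * ε^2 * 1 + (D * ε^2 * B) * B + ((B * ε) * (B * ε)) * B + B * ε^2 * 1 + B * ε^2 * B ≤ ((1 + B) * D * Real.exp B + D * (1 + B^2) + B^3 + B * (1 + B)) * ε^2 := le_of_eq (by ring)
  linarith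
theorem w_int (a : ℝ) (ha : 0 < a) :
    IntegrableOn (fun x : ℝ => 1 / Real.sqrt (|x| * (x + a))) (Set.Ioo (-a) 0) := by
  have h1 : IntervalIntegrable (fun x : ℝ => (x + a) ^ (-(1:ℝ)/2)) volume (-a) 0 := by
    have := (intervalIntegral.intervalIntegrable_rpow' (a := 0) (b := a) (r := -(1:ℝ)/2) (by norm_num)).comp_add_right a
    simpa using this
  have h2 : IntervalIntegrable (fun x : ℝ => (-x) ^ (-(1:ℝ)/2)) volume (-a) 0 := by
    have := (intervalIntegral.intervalIntegrable_rpow' (a := a) (b := 0) (r := -(1:ℝ)/2) (by norm_num)).comp_sub_left 0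
    simpa using this
  have h3 := ((h1.add h2).const_mul (1 / Real.sqrt a))
  rw [intervalIntegrable_iff_integrableOn_Ioo_of_le (by linarith)] at h3
  refine Integrable.mono' h3 ?_ ?_
  · apply Measurable.aestronglyMeasurable
    fun_prop
  · refine (ae_restrict_iff' measurableSet_Ioo).2 (Filter.Eventually.of_forall ?_)
    intro x hx
    have e1 : 0 < x + a := by linarith [hx.1]
    have e2 : 0 < -x := by linarith [hx.2]
    have r1 : ∀ y : ℝ, 0 < y → y ^ (-(1:ℝ)/2) = 1 / Real.sqrt y := by
      intro y hy
      rw [Real.sqrt_eq_rpow, neg_div, Real.rpow_neg hy.le, ← one_div (y ^ _)]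
    rw [r1 _ e1, r1 _ e2, abs_of_neg hx.2, Real.sqrt_mul e2.le, Real.norm_of_nonneg (by positivity)]
    have s1 := Real.sq_sqrt e1.le
    have s2 := Real.sq_sqrt e2.le
    have p1 := Real.sqrt_pos.2 e1
    have p2 := Real.sqrt_pos.2 e2
    have hle : Real.sqrt a ≤ Real.sqrt (x+a) + Real.sqrt (-x) := by
      rw [Real.sqrt_le_left (by positivity)]
      nlinarith
    have p3 := Real.sqrt_pos.2 ha
    rw [div_add_div _ _ p1.ne' p2.ne', ← mul_div_mul_comm, div_le_div_iff₀ (by positivity) (by positivity)]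
    have : 0 < √(-x) * √(x+a) := by positivity
    nlinarith

theorem F_int (b s : ℝ) (hb : 0 < b) :
    IntegrableOn (fun u : ℝ => u ^ (-(1:ℝ)/2) * Real.log (1 + Real.exp (-s - b * u))) (Set.Ioi 0) := by
  have h := integrableOn_rpow_mul_exp_neg_mul_rpow (s := -(1:ℝ)/2) (p := 1) (b := b) (by norm_num) (by norm_num) hb
  refine Integrable.mono' (h.const_mul (Real.exp (-s))) ?_ ?_
  · apply Measurable.aestronglyMeasurable
    fun_prop
  · refine (ae_restrict_iff' measurableSet_Ioi).2 (Filter.Eventually.of_forall ?_)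
    intro x hx
    have hx : 0 < x := hx
    obtain ⟨l1, l2⟩ := log1p_bd (-s - b * x)
    rw [Real.norm_of_nonneg (by positivity), Real.rpow_one]
    have : Real.exp (-s - b*x) = Real.exp (-s) * Real.exp (-b * x) := by rw [← Real.exp_add]; congr 1; ring
    calc _ ≤ x ^ (-(1:ℝ)/2) * (Real.exp (-s) * Real.exp (-b * x)) := by
          rw [← this]; gcongr
      _ = _ := by ring

theorem F_bd (s0 : ℝ) : ∃ C > 0, ∀ s : ℝ, -s0 ≤ s →
    |∫ v in Set.Ioi (0 : ℝ), v ^ (-(1:ℝ)/2) * Real.log (1 + Real.exp (-s - v))| ≤ C := by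
  have hi := F_int 1 (-s0) one_pos
  refine ⟨|∫ v in Set.Ioi (0 : ℝ), v ^ (-(1:ℝ)/2) * Real.log (1 + Real.exp (-(-s0) - 1 * v))| + 1, by positivity, ?_⟩
  intro s hs
  have := norm_integral_le_of_norm_le (f := fun v : ℝ => v ^ (-(1:ℝ)/2) * Real.log (1 + Real.exp (-s - v))) hi ?_
  · rw [Real.norm_eq_abs] at this
    exact this.trans ((le_abs_self _).trans (by linarith))
  · refine (ae_restrict_iff' measurableSet_Ioi).2 (Filter.Eventually.of_forall ?_)
    intro x hx
    have hx : 0 < x := hx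
    obtain ⟨l1, l2⟩ := log1p_bd (-s - x)
    rw [Real.norm_of_nonneg (by positivity)]
    gcongr
    linarith

theorem F_scale (b s : ℝ) (hb : 0 < b) :
    ∫ u in Set.Ioi (0:ℝ), u ^ (-(1:ℝ)/2) * Real.log (1 + Real.exp (-s - b * u)) = 
      b ^ (-(1:ℝ)/2) * ∫ v in Set.Ioi (0 : ℝ), v ^ (-(1:ℝ)/2) * Real.log (1 + Real.exp (-s - v)) := by
  have h := integral_comp_mul_left_Ioi (fun v : ℝ => v ^ (-(1:ℝ)/2) * Real.log (1 + Real.exp (-s - v))) 0 hb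
  simp only [mul_zero, smul_eq_mul] at h
  have h2 : ∫ x in Set.Ioi (0:ℝ), (b * x) ^ (-(1:ℝ)/2) * Real.log (1 + Real.exp (-s - b * x)) =
     b ^ (-(1:ℝ)/2) * ∫ u in Set.Ioi (0:ℝ), u ^ (-(1:ℝ)/2) * Real.log (1 + Real.exp (-s - b * u)) := by
    rw [← integral_const_mul]
    refine setIntegral_congr_fun measurableSet_Ioi ?_
    intro x hx
    have hx : 0 < x := hx
    simp only
    rw [Real.mul_rpow hb.le hx.le]; ring
  rw [h2] at h
  have h3 : b ^ (-(1:ℝ)/2) * b ^ (-(1:ℝ)/2) = b⁻¹ := by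
    rw [← Real.rpow_add hb, ← Real.rpow_neg_one]; norm_num
  have hp : 0 < b ^ (-(1:ℝ)/2) := by positivity
  apply mul_left_cancel₀ hp.ne'
  rw [h, ← h3]; ring

theorem tail_bd (a t s0 : ℝ) (ha : 0 < a) (ht : 0 < t) : ∃ C > 0, ∀ N s : ℝ, 0 < N → -s0 ≤ s →
    |∫ u in Set.Ioi a, u ^ (-(1:ℝ)/2) * Real.log (1 + Real.exp (-s - N * t * u))| ≤ C * N⁻¹ := by
  have hi := integrableOn_Ioi_rpow_of_lt (a := -(3:ℝ)/2) (c := a) (by norm_num) ha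
  refine ⟨Real.exp s0 / t * |∫ u in Set.Ioi a, u ^ (-(3:ℝ)/2)| + 1, by positivity, ?_⟩
  intro N s hN hs
  have := norm_integral_le_of_norm_le (f := fun u : ℝ => u ^ (-(1:ℝ)/2) * Real.log (1 + Real.exp (-s - N * t * u)))
    (hi.const_mul (Real.exp s0 / t * N⁻¹)) ?_
  · rw [integral_const_mul] at this
    refine this.trans ?_
    have hN' : 0 < N⁻¹ := by positivity
    have h2 : Real.exp s0 / t * N⁻¹ * (∫ u in Set.Ioi a, u ^ (-(3:ℝ)/2)) ≤ Real.exp s0 / t * N⁻¹ * |∫ u in Set.Ioi a, u ^ (-(3:ℝ)/2)| := by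
      gcongr; exact le_abs_self _
    linarith
  · refine (ae_restrict_iff' measurableSet_Ioi).2 (Filter.Eventually.of_forall ?_)
    intro x hx
    have hx : 0 < x := ha.trans hx
    obtain ⟨l1, l2⟩ := log1p_bd (-s - N * t * x)
    rw [Real.norm_of_nonneg (by positivity)]
    have e1 : Real.exp (-s - N*t*x) ≤ Real.exp s0 * Real.exp (- (N*t*x)) := by
      rw [← Real.exp_add]; gcongr; linarith
    have hy : 0 < N * t * x := by positivity
    have e2 : Real.exp (-(N*t*x)) ≤ (N*t*x)⁻¹ := by
      rw [Real.exp_neg]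
      gcongr
      linarith [Real.add_one_le_exp (N*t*x)]
    have e3 : x ^ (-(3:ℝ)/2) = x ^ (-(1:ℝ)/2) * x⁻¹ := by
      rw [← Real.rpow_neg_one x, ← Real.rpow_add hx]; norm_num
    rw [e3]
    calc _ ≤ x ^ (-(1:ℝ)/2) * (Real.exp s0 * (N*t*x)⁻¹) := by
          gcongr
          exact (l2.trans e1).trans (by gcongr)
      _ = _ := by field_simp

theorem J_int (a t s0 : ℝ) (ha : 0 < a) (ht : 0 < t) : ∃ C > 0, ∀ N s : ℝ, 0 < N → -s0 ≤ s →
    |(∫ x in Set.Ioo (-a) 0, Real.log (1 + Real.exp (-s - N * (t * (-x)))) / Real.sqrt (-x)) -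
      (N * t) ^ (-(1:ℝ)/2) * ∫ v in Set.Ioi (0 : ℝ), v ^ (-(1:ℝ)/2) * Real.log (1 + Real.exp (-s - v))| ≤ C * N⁻¹ := by
  obtain ⟨C, hC, h⟩ := tail_bd a t s0 ha ht
  refine ⟨C, hC, ?_⟩
  intro N s hN hs
  have h1 := h N s hN hs
  have hNt : 0 < N * t := by positivity
  rw [← F_scale (N*t) s hNt]
  have hi := F_int (N*t) s hNt
  rw [← intervalIntegral.integral_interval_add_Ioi hi (hi.mono_set (Set.Ioi_subset_Ioi ha.le))]
  have e : (∫ x in Set.Ioo (-a) 0, Real.log (1 + Real.exp (-s - N * (t * (-x)))) / Real.sqrt (-x)) = 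
     ∫ u in (0:ℝ)..a, u ^ (-(1:ℝ)/2) * Real.log (1 + Real.exp (-s - N * t * u)) := by
    have := intervalIntegral.integral_comp_neg (a := -a) (b := 0) (fun u : ℝ => u ^ (-(1:ℝ)/2) * Real.log (1 + Real.exp (-s - N * t * u)))
    simp only [neg_neg, neg_zero] at this
    rw [← this, intervalIntegral.integral_of_le (by linarith), integral_Ioc_eq_integral_Ioo]
    refine setIntegral_congr_fun measurableSet_Ioo ?_
    intro x hx
    have e2 : 0 < -x := by linarith [hx.2]
    simp only
    rw [Real.sqrt_eq_rpow, neg_div 2 1, Real.rpow_neg e2.le, mul_assoc]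
    field_simp
  rw [e]
  simpa using h1

theorem ptw (a t c A s0 B : ℝ) (ha : 0 < a) (ht : 0 < t) (hc : 0 < c) (hct : c ≤ t) (hA : 0 < A) (hB : 0 < B)
    (N s x Qx : ℝ) (k k0 : ℂ) (hN : 0 < N) (hs : -s0 ≤ s) (hx : x ∈ Set.Ioo (-a) (0:ℝ))
    (hQ1 : c * (-x) ≤ Qx) (hQ2 : |Qx + t * x| ≤ A * x ^ 2) (hk : ‖k‖ ≤ B) (hk0 : ‖k0‖ ≤ B) (hkk : ‖k - k0‖ ≤ B * (-x)) :
    ‖((Real.log (1 + Real.exp (-s - N * Qx)) / Real.sqrt (|x| * (x + a)) : ℝ) : ℂ) * k - 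
      ((Real.log (1 + Real.exp (-s - N * (t * (-x)))) / Real.sqrt (-x) : ℝ) : ℂ) * (((Real.sqrt a)⁻¹ : ℝ) * k0)‖ ≤ 
      (A * Real.exp s0 * (2 / c^2) * B + Real.exp s0 / t * B + Real.exp s0 / t / a * B) * N⁻¹ * (1 / Real.sqrt (|x| * (x + a))) := by
  have hx1 : 0 < x + a := by linarith [hx.1]
  obtain ⟨u, rfl⟩ : ∃ u, x = -u := ⟨-x, by ring⟩
  have hu : 0 < u := by linarith [hx.2]
  simp only [neg_neg, abs_neg, abs_of_pos hu] at *
  set w := 1 / Real.sqrt (u * (-u + a)) with hw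
  have hwp : 0 < w := by positivity
  set l1 := Real.log (1 + Real.exp (-s - N * Qx)) with hl1
  set l2 := Real.log (1 + Real.exp (-s - N * (t * u))) with hl2
  obtain ⟨b1, b2⟩ := log1p_bd (-s - N * (t * u))
  rw [← hl2] at b1 b2
  have d1 : |l1 - l2| ≤ A * Real.exp s0 * (2/c^2) * N⁻¹ := by
    have hy1 : N * (c * u) ≤ N * Qx := by gcongr
    have hy2 : N * (c * u) ≤ N * (t * u) := by gcongr
    have := log1p_abs (-s - N * Qx) (-s - N * (t * u)) (s0 + - (c * (N * u))) (by linarith) (by linarith)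
    rw [Real.exp_add] at this
    have h3 : |(-s - N * Qx) - (-s - N * (t * u))| ≤ N * (A * u^2) := by
      rw [show (-s - N * Qx) - (-s - N * (t * u)) = - (N * (Qx + t * (-u))) by ring, abs_neg, abs_mul, abs_of_pos hN]
      gcongr
      simpa using hQ2
    have h4 : Real.exp (-(c * (N*u))) ≤ 2 / (c * (N * u))^2 := by
      have := Real.pow_div_factorial_le_exp (c * (N*u)) (by positivity) 2
      rw [Real.exp_neg, ← inv_div]
      gcongr
      simpa using this
    calc _ ≤ _ := this
      _ ≤ N * (A * u^2) * (Real.exp s0 * (2 / (c * (N * u))^2)) := by gcongr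
      _ = _ := by field_simp
  have d2 : l2 * u ≤ Real.exp s0 / t * N⁻¹ := by
    have e1 : Real.exp (-s - N*(t*u)) ≤ Real.exp s0 * Real.exp (- (N*(t*u))) := by
      rw [← Real.exp_add]; gcongr; linarith
    have e2 : Real.exp (-(N*(t*u))) ≤ (N*(t*u))⁻¹ := by
      rw [Real.exp_neg]
      gcongr
      linarith [Real.add_one_le_exp (N*(t*u))]
    calc _ ≤ (Real.exp s0 * (N*(t*u))⁻¹) * u := by
          gcongr
          exact (b2.trans e1).trans (by gcongr)
      _ = _ := by field_simp
  have d3 : |w - (Real.sqrt u)⁻¹ * (Real.sqrt a)⁻¹| ≤ u / a * w := by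
    have p1 := Real.sqrt_pos.2 ha
    have p2 := Real.sqrt_pos.2 hu
    have p3 := Real.sqrt_pos.2 hx1
    have q1 := Real.sq_sqrt ha.le
    have q3 := Real.sq_sqrt hx1.le
    have hle : Real.sqrt (-u+a) ≤ Real.sqrt a := Real.sqrt_le_sqrt (by linarith)
    rw [hw, Real.sqrt_mul hu.le]
    have e : 1 / (√u * √(-u + a)) - (√u)⁻¹ * (√a)⁻¹ = (1 - √(-u+a) / √a) * (1 / (√u * √(-u + a))) := by field_simp
    have hf : √(-u+a) / √a ≤ 1 := (div_le_one p1).2 hle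
    rw [e, abs_of_nonneg (mul_nonneg (by linarith) (by positivity))]
    gcongr
    have hsq : (√(-u+a) / √a)^2 = 1 - u / a := by
      rw [div_pow, q1, q3]; field_simp; ring
    have : 0 ≤ √(-u+a) / √a := by positivity
    nlinarith
  have id : ((l1 / Real.sqrt (u * (-u + a)) : ℝ) : ℂ) * k - 
      ((l2 / Real.sqrt u : ℝ) : ℂ) * (((Real.sqrt a)⁻¹ : ℝ) * k0) = 
      (((l1 - l2) * w : ℝ) : ℂ) * k + ((l2 * w : ℝ) : ℂ) * (k - k0) + ((l2 * (w - (Real.sqrt u)⁻¹ * (Real.sqrt a)⁻¹) : ℝ) : ℂ) * k0 := by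
    rw [hw]; push_cast; ring
  rw [id]
  have t1 : ‖(((l1 - l2) * w : ℝ) : ℂ) * k‖ ≤ (A * Real.exp s0 * (2/c^2) * N⁻¹) * w * B := by
    rw [norm_mul, Complex.norm_real, norm_mul, Real.norm_eq_abs, Real.norm_of_nonneg hwp.le]; gcongr
  have t2 : ‖((l2 * w : ℝ) : ℂ) * (k - k0)‖ ≤ (Real.exp s0 / t * N⁻¹) * w * B := by
    rw [norm_mul, Complex.norm_real, Real.norm_of_nonneg (by positivity)]
    calc _ ≤ l2 * w * (B * u) := by gcongr
      _ = (l2 * u) * w * B := by ring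
      _ ≤ _ := by gcongr
  have t3 : ‖((l2 * (w - (Real.sqrt u)⁻¹ * (Real.sqrt a)⁻¹) : ℝ) : ℂ) * k0‖ ≤ (Real.exp s0 / t * N⁻¹) / a * w * B := by
    rw [norm_mul, Complex.norm_real, norm_mul, Real.norm_of_nonneg b1, Real.norm_eq_abs]
    calc _ ≤ l2 * (u / a * w) * B := by gcongr
      _ = (l2 * u) / a * w * B := by ring
      _ ≤ _ := by gcongr
  calc _ ≤ _ := norm_add₃_le
    _ ≤ _ := add_le_add (add_le_add t1 t2) t3
    _ = _ := by ring

theorem main_int (a t c A s0 B : ℝ) (ha : 0 < a) (ht : 0 < t) (hc : 0 < c) (hct : c ≤ t) (hA : 0 < A) (hB : 0 < B)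
    (Q : ℝ → ℝ) (hQc : ContinuousOn Q (Set.Icc (-a) 0))
    (hQ : ∀ x ∈ Set.Ioo (-a) (0:ℝ), c * (-x) ≤ Q x ∧ |Q x + t * x| ≤ A * x ^ 2) :
    ∃ C > 0, ∀ (N s : ℝ) (k : ℝ → ℂ) (k0 : ℂ), 0 < N → -s0 ≤ s → ContinuousOn k (Set.Ioo (-a) 0) →
      ‖k0‖ ≤ B → (∀ x ∈ Set.Ioo (-a) (0:ℝ), ‖k x‖ ≤ B ∧ ‖k x - k0‖ ≤ B * (-x)) →
      ‖(∫ x in Set.Ioo (-a) 0, ((Real.log ((1 + Real.exp (-s - N * Q x))⁻¹) / Real.sqrt (|x| * (x + a)) : ℝ) : ℂ) * k x)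
        + (N ^ (-(1:ℝ)/2) * (∫ v in Set.Ioi (0 : ℝ), v ^ (-(1:ℝ)/2) * Real.log (1 + Real.exp (-s - v))) / (Real.sqrt a * Real.sqrt t) : ℝ) * k0‖ ≤ C * N⁻¹ := by
  obtain ⟨C1, hC1, hJ⟩ := J_int a t s0 ha ht
  set D := (A * Real.exp s0 * (2 / c^2) * B + Real.exp s0 / t * B + Real.exp s0 / t / a * B) with hD
  have hw := w_int a ha
  set W := ∫ x in Set.Ioo (-a) (0:ℝ), 1 / Real.sqrt (|x| * (x + a)) with hW
  have hW0 : 0 ≤ W := setIntegral_nonneg measurableSet_Ioo (fun x hx => by positivity)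
  refine ⟨D * W + C1 * ((Real.sqrt a)⁻¹ * B), by positivity, ?_⟩
  intro N s k k0 hN hs hkc hk0 hk
  set f : ℝ → ℂ := fun x => ((Real.log (1 + Real.exp (-s - N * Q x)) / Real.sqrt (|x| * (x + a)) : ℝ) : ℂ) * k x with hf
  set g : ℝ → ℂ := fun x => ((Real.log (1 + Real.exp (-s - N * (t * (-x)))) / Real.sqrt (-x) : ℝ) : ℂ) * (((Real.sqrt a)⁻¹ : ℝ) * k0) with hg
  have hfm : AEStronglyMeasurable f (volume.restrict (Set.Ioo (-a) 0)) := by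
    refine ContinuousOn.aestronglyMeasurable ?_ measurableSet_Ioo
    refine ContinuousOn.mul (Complex.continuous_ofReal.comp_continuousOn ?_) hkc
    refine ContinuousOn.div ?_ (by fun_prop) ?_
    · have : ContinuousOn Q (Set.Ioo (-a) 0) := hQc.mono Set.Ioo_subset_Icc_self
      refine ContinuousOn.log (by fun_prop) ?_
      intro x hx; positivity
    · intro x hx
      have e1 : 0 < x + a := by linarith [hx.1]
      have e2 : 0 < |x| := abs_pos.2 hx.2.ne
      positivity
  have hfi : IntegrableOn f (Set.Ioo (-a) 0) := by
    refine Integrable.mono' (hw.const_mul (Real.exp s0 * B)) hfm ?_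
    refine (ae_restrict_iff' measurableSet_Ioo).2 (Filter.Eventually.of_forall ?_)
    intro x hx
    obtain ⟨l1, l2⟩ := log1p_bd (-s - N * Q x)
    have hq := (hQ x hx).1
    have : 0 ≤ N * Q x := by
      have : 0 < -x := by linarith [hx.2]
      have : 0 < c * -x := by positivity
      have : 0 ≤ Q x := by linarith
      positivity
    have l3 : Real.exp (-s - N * Q x) ≤ Real.exp s0 := Real.exp_le_exp.2 (by linarith)
    rw [hf]
    simp only
    rw [norm_mul, Complex.norm_real, Real.norm_of_nonneg (by positivity)]
    calc _ ≤ Real.exp s0 / √(|x| * (x + a)) * B := by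
          gcongr
          · exact l2.trans l3
          · exact (hk x hx).1
      _ = _ := by ring
  have hpt : ∀ x ∈ Set.Ioo (-a) (0:ℝ), ‖f x - g x‖ ≤ D * N⁻¹ * (1 / Real.sqrt (|x| * (x + a))) := by
    intro x hx
    exact ptw a t c A s0 B ha ht hc hct hA hB N s x (Q x) (k x) k0 hN hs hx (hQ x hx).1 (hQ x hx).2 (hk x hx).1 hk0 (hk x hx).2
  have hgm : AEStronglyMeasurable g (volume.restrict (Set.Ioo (-a) 0)) := by
    apply Measurable.aestronglyMeasurable
    fun_prop
  have hae : ∀ᵐ x ∂(volume.restrict (Set.Ioo (-a) 0)), ‖f x - g x‖ ≤ D * N⁻¹ * (1 / Real.sqrt (|x| * (x + a))) :=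
    (ae_restrict_iff' measurableSet_Ioo).2 (Filter.Eventually.of_forall hpt)
  have hfgi : IntegrableOn (fun x => f x - g x) (Set.Ioo (-a) 0) :=
    Integrable.mono' (hw.const_mul (D * N⁻¹)) (hfm.sub hgm) hae
  have hgi : IntegrableOn g (Set.Ioo (-a) 0) := by
    have := hfi.sub hfgi
    refine this.congr (Filter.Eventually.of_forall ?_)
    intro x; simp
  have h1 := norm_integral_le_of_norm_le (hw.const_mul (D * N⁻¹)) hae
  rw [integral_sub hfi hgi, integral_const_mul, ← hW] at h1
  have hgJ : ∫ x in Set.Ioo (-a) 0, g x = ((∫ x in Set.Ioo (-a) 0, Real.log (1 + Real.exp (-s - N * (t * (-x)))) / Real.sqrt (-x) : ℝ) : ℂ) * (((Real.sqrt a)⁻¹ : ℝ) * k0) := by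
    rw [hg, integral_mul_const]
    congr 1
    exact integral_ofReal
  have hfI : (∫ x in Set.Ioo (-a) 0, ((Real.log ((1 + Real.exp (-s - N * Q x))⁻¹) / Real.sqrt (|x| * (x + a)) : ℝ) : ℂ) * k x) = - ∫ x in Set.Ioo (-a) 0, f x := by
    rw [← integral_neg]
    congr 1
    ext x
    rw [hf, Real.log_inv]; push_cast; ring
  rw [hfI]
  have hJ' := hJ N s hN hs
  set J := ∫ x in Set.Ioo (-a) 0, Real.log (1 + Real.exp (-s - N * (t * (-x)))) / Real.sqrt (-x)
  set F := ∫ v in Set.Ioi (0 : ℝ), v ^ (-(1:ℝ)/2) * Real.log (1 + Real.exp (-s - v))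
  have hNt : (N * t) ^ (-(1:ℝ)/2) = N ^ (-(1:ℝ)/2) / Real.sqrt t := by
    rw [Real.mul_rpow hN.le ht.le, Real.sqrt_eq_rpow, neg_div, Real.rpow_neg ht.le]; rfl
  have id : (-∫ x in Set.Ioo (-a) 0, f x) + (N ^ (-(1:ℝ)/2) * F / (Real.sqrt a * Real.sqrt t) : ℝ) * k0
     = -((∫ x in Set.Ioo (-a) 0, f x) - ∫ x in Set.Ioo (-a) 0, g x) - ((J - (N * t) ^ (-(1:ℝ)/2) * F : ℝ) : ℂ) * (((Real.sqrt a)⁻¹ : ℝ) * k0) := by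
    rw [hgJ, hNt]
    have : ((N ^ (-(1:ℝ)/2) * F / (Real.sqrt a * Real.sqrt t) : ℝ) : ℂ) = ((N ^ (-(1:ℝ)/2) / Real.sqrt t * F : ℝ) : ℂ) * ((Real.sqrt a)⁻¹ : ℝ) := by
      rw [← Complex.ofReal_mul]; congr 1; field_simp
    rw [this]
    push_cast
    ring
  rw [id]
  calc _ ≤ _ := norm_sub_le _ _
    _ ≤ D * N⁻¹ * W + C1 * N⁻¹ * ((Real.sqrt a)⁻¹ * B) := by
      rw [norm_neg, norm_mul _ (_ * k0), norm_mul _ k0, Complex.norm_real, Complex.norm_real, Real.norm_of_nonneg (show 0 ≤ (Real.sqrt a)⁻¹ by positivity), Real.norm_eq_abs]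
      gcongr
    _ = _ := by ring

theorem mat_lem (m q p : ℂ) (hm : m ≠ 0) (σ3 U0 M : Matrix (Fin 2) (Fin 2) ℂ)
    (hσ3 : σ3 = !![1, 0; 0, -1])
    (hU0 : U0 = (Real.sqrt 2 : ℂ)⁻¹ • !![1, Complex.I; Complex.I, 1])
    (hM : M = U0 * !![m, 0; 0, m⁻¹] * U0⁻¹) :
    (∀ i j, ‖(M * σ3 * M⁻¹) i j‖ ≤ ‖m‖^2 + ‖m⁻¹‖^2) ∧
    M * (!![Complex.exp (-p), 0; 0, Complex.exp p] * M * !![Complex.exp q, 0; 0, Complex.exp (-q)])⁻¹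
      = (((Complex.exp (-q) + Complex.exp q) / 2) • (1 : Matrix (Fin 2) (Fin 2) ℂ) + ((Complex.exp (-q) - Complex.exp q) / 2) • (M * σ3 * M⁻¹))
        * !![Complex.exp p, 0; 0, Complex.exp (-p)] := by
  have h2 : ((Real.sqrt 2 : ℝ) : ℂ)⁻¹ * ((Real.sqrt 2 : ℝ) : ℂ)⁻¹ = 1/2 := by
    rw [← mul_inv, ← Complex.ofReal_mul, Real.mul_self_sqrt (by norm_num)]; norm_num
  have hUi : U0⁻¹ = (Real.sqrt 2 : ℂ)⁻¹ • !![1, -Complex.I; -Complex.I, 1] := by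
    refine Matrix.inv_eq_right_inv ?_
    rw [hU0, smul_mul_smul_comm, h2]
    ext i j; fin_cases i <;> fin_cases j <;> simp <;> norm_num
  have hM1 : M = (1/2 : ℂ) • !![m + m⁻¹, -Complex.I * (m - m⁻¹); Complex.I * (m - m⁻¹), m + m⁻¹] := by
    rw [hM, hUi, hU0, Matrix.smul_mul, smul_mul_smul_comm, h2]
    congr 1
    ext i j; fin_cases i <;> fin_cases j <;> simp [Matrix.mul_apply, Fin.sum_univ_two] <;> ring_nf <;> simp <;> ring
  have hMi : M * ((1/2 : ℂ) • !![m + m⁻¹, Complex.I * (m - m⁻¹); -Complex.I * (m - m⁻¹), m + m⁻¹]) = 1 := by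
    rw [hM1, smul_mul_smul_comm]
    ext i j; fin_cases i <;> fin_cases j <;> simp [Matrix.mul_apply, Fin.sum_univ_two] <;> field_simp <;> ring_nf <;> simp <;> ring
  have hMM : M * M⁻¹ = 1 := by rw [Matrix.inv_eq_right_inv hMi]; exact hMi
  have hP : M * σ3 * M⁻¹ = (1/2 : ℂ) • !![m^2 + m⁻¹^2, Complex.I * (m^2 - m⁻¹^2); Complex.I * (m^2 - m⁻¹^2), -(m^2 + m⁻¹^2)] := by
    rw [Matrix.inv_eq_right_inv hMi, hM1, hσ3, Matrix.smul_mul, smul_mul_smul_comm]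
    ext i j; fin_cases i <;> fin_cases j <;> simp [Matrix.mul_apply, Fin.sum_univ_two] <;> field_simp <;> ring_nf <;> simp <;> ring
  constructor
  · intro i j
    rw [hP]
    have b1 : ‖m^2 + m⁻¹^2‖ ≤ ‖m‖^2 + ‖m⁻¹‖^2 := (norm_add_le _ _).trans (by rw [norm_pow, norm_pow])
    have b2 : ‖m^2 - m⁻¹^2‖ ≤ ‖m‖^2 + ‖m⁻¹‖^2 := (norm_sub_le _ _).trans (by rw [norm_pow, norm_pow])
    have b3 : ‖-(m^2 + m⁻¹^2)‖ ≤ ‖m‖^2 + ‖m⁻¹‖^2 := by rw [norm_neg]; exact b1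
    have b4 : ‖Complex.I * (m^2 - m⁻¹^2)‖ ≤ ‖m‖^2 + ‖m⁻¹‖^2 := by rw [norm_mul]; simpa using b2
    have half : ∀ w : ℂ, ‖w‖ ≤ ‖m‖^2 + ‖m⁻¹‖^2 → ‖(1/2:ℂ) * w‖ ≤ ‖m‖^2 + ‖m⁻¹‖^2 := by
      intro w hw
      rw [norm_mul]
      have := norm_nonneg w
      norm_num
      norm_num at hw
      linarith
    rw [Matrix.smul_apply, smul_eq_mul]
    fin_cases i <;> fin_cases j
    · exact half _ b1
    · exact half _ b4
    · exact half _ b4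
    · exact half _ b3
  · have ex : Complex.exp q * Complex.exp (-q) = 1 := by rw [← Complex.exp_add]; simp
    have ep : Complex.exp p * Complex.exp (-p) = 1 := by rw [← Complex.exp_add]; simp
    have i1 : (!![Complex.exp q, 0; 0, Complex.exp (-q)] : Matrix (Fin 2) (Fin 2) ℂ)⁻¹ = !![Complex.exp (-q), 0; 0, Complex.exp q] := by
      refine Matrix.inv_eq_right_inv ?_
      ext i j; fin_cases i <;> fin_cases j <;> simp [ex, mul_comm]
    have i2 : (!![Complex.exp (-p), 0; 0, Complex.exp p] : Matrix (Fin 2) (Fin 2) ℂ)⁻¹ = !![Complex.exp p, 0; 0, Complex.exp (-p)] := by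
      refine Matrix.inv_eq_right_inv ?_
      ext i j; fin_cases i <;> fin_cases j <;> simp [ep, mul_comm]
    have dd : (!![Complex.exp (-q), 0; 0, Complex.exp q] : Matrix (Fin 2) (Fin 2) ℂ) = ((Complex.exp (-q) + Complex.exp q) / 2) • (1 : Matrix (Fin 2) (Fin 2) ℂ) + ((Complex.exp (-q) - Complex.exp q) / 2) • σ3 := by
      rw [hσ3]
      ext i j; fin_cases i <;> fin_cases j <;> simp <;> ring
    rw [Matrix.mul_inv_rev, Matrix.mul_inv_rev, i1, i2, dd, ← mul_assoc, ← mul_assoc]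
    congr 1
    rw [mul_add, add_mul, mul_smul_comm, mul_smul_comm, smul_mul_assoc, smul_mul_assoc, mul_one, hMM]

theorem dist_lem (a : ℝ) (S : Set ℂ) (hS : S = {z : ℂ | ¬(z.im = 0 ∧ -a ≤ z.re ∧ z.re ≤ 0)})
    (Kc : Set ℂ) (hKc : IsCompact Kc) (hKcS : Kc ⊆ S) :
    ∃ δ > 0, ∀ z ∈ Kc, ∀ x ∈ Set.Icc (-a) (0:ℝ), δ ≤ ‖(x:ℂ) - z‖ := by
  have hc : IsCompact ((fun x : ℝ => (x:ℂ)) '' Set.Icc (-a) 0) := isCompact_Icc.image Complex.continuous_ofReal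
  have hd : Disjoint Kc ((fun x : ℝ => (x:ℂ)) '' Set.Icc (-a) 0) := by
    rw [Set.disjoint_left]
    rintro z hz ⟨x, hx, rfl⟩
    have := hKcS hz
    rw [hS] at this
    exact this ⟨by simp, by simpa using hx.1, by simpa using hx.2⟩
  obtain ⟨δ, hδ, h⟩ := hd.exists_thickenings hKc hc.isClosed
  refine ⟨δ, hδ, ?_⟩
  intro z hz x hx
  by_contra hlt
  push Not at hlt
  have m1 : (x:ℂ) ∈ Metric.thickening δ Kc :=
    Metric.mem_thickening_iff.2 ⟨z, hz, by rwa [dist_eq_norm]⟩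
  have m2 : (x:ℂ) ∈ Metric.thickening δ ((fun x : ℝ => (x:ℂ)) '' Set.Icc (-a) 0) :=
    Metric.mem_thickening_iff.2 ⟨x, ⟨x, hx, rfl⟩, by simpa using hδ⟩
  exact Set.disjoint_left.1 h m1 m2

set_option maxHeartbeats 4000000 in
/-- entrywise matching estimate `M(z) G_n(z|s)^{-1} =
I + n^{-1/3}(q_0^{(1)} σ₃ - q^{(1)} M σ₃ M^{-1}) + O(n^{-2/3})`, uniformly on compact subsets
of `ℂ ∖ [-a,0]` and for `s ≥ -s₀`. -/
theorem stmt_10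
    (a t : ℝ) (ha : 0 < a) (ht : 0 < t)
    (Q : ℝ → ℝ)
    (hQcont : ContinuousOn Q (Set.Icc (-a) 0))
    (hQpos : ∀ x ∈ Set.Ico (-a) (0 : ℝ), 0 < Q x)
    (hQ0 : Q 0 = 0)
    (hQsm : ∃ U : Set ℝ, IsOpen U ∧ (0 : ℝ) ∈ U ∧ ContDiffOn ℝ (⊤ : ℕ∞) Q U)
    (hQder : deriv Q 0 = -t)
    (S : Set ℂ) (hS : S = {z : ℂ | ¬(z.im = 0 ∧ -a ≤ z.re ∧ z.re ≤ 0)})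
    (r : ℂ → ℂ)
    (hr_an : DifferentiableOn ℂ r S)
    (hr_sq : ∀ z ∈ S, (r z) ^ 2 = (z + Complex.ofReal a) * z)
    (hr_pos : ∀ x : ℝ, 0 < x → (r (Complex.ofReal x)).im = 0 ∧ 0 < (r (Complex.ofReal x)).re)
    (mq : ℂ → ℂ)
    (hmq_an : DifferentiableOn ℂ mq S)
    (hmq_pow : ∀ z ∈ S, (mq z) ^ 4 = z / (z + Complex.ofReal a))
    (hmq_pos : ∀ x : ℝ, 0 < x →
      (mq (Complex.ofReal x)).im = 0 ∧ 0 < (mq (Complex.ofReal x)).re)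
    (q0 : ℕ → ℝ → ℝ)
    (hq0 : ∀ (n : ℕ) (s : ℝ), q0 n s = -(2 * Real.pi)⁻¹ *
      ∫ x in Set.Ioo (-a) (0 : ℝ),
        Real.log ((1 + Real.exp (-s - (n : ℝ) ^ ((2 : ℝ) / 3) * Q x))⁻¹) /
          Real.sqrt (|x| * (x + a)))
    (q : ℕ → ℝ → ℂ → ℂ)
    (hq : ∀ (n : ℕ) (s : ℝ) (z : ℂ), q n s z =
      r z / (2 * Real.pi) *
        ∫ x in Set.Ioo (-a) (0 : ℝ),
          Complex.ofReal
              (Real.log ((1 + Real.exp (-s - (n : ℝ) ^ ((2 : ℝ) / 3) * Q x))⁻¹) /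
                Real.sqrt (|x| * (x + a))) /
            (Complex.ofReal x - z))
    (F : ℝ → ℝ → ℝ)
    (hF : ∀ β y, F β y = ∫ v in Set.Ioi (0 : ℝ), v ^ β * Real.log (1 + Real.exp (-y - v)))
    (q01 : ℝ → ℝ)
    (hq01 : ∀ s, q01 s = F (-(1 : ℝ) / 2) s / (2 * Real.pi * Real.sqrt a * Real.sqrt t))
    (σ3 U0 : Matrix (Fin 2) (Fin 2) ℂ)
    (hσ3 : σ3 = !![1, 0; 0, -1])
    (hU0 : U0 = (Real.sqrt 2 : ℂ)⁻¹ • !![1, Complex.I; Complex.I, 1])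
    (Mm : ℂ → Matrix (Fin 2) (Fin 2) ℂ)
    (hMm : ∀ z, Mm z = U0 * !![mq z, 0; 0, (mq z)⁻¹] * U0⁻¹)
    (G : ℕ → ℝ → ℂ → Matrix (Fin 2) (Fin 2) ℂ)
    (hG : ∀ (n : ℕ) (s : ℝ) (z : ℂ), G n s z =
      !![Complex.exp (Complex.ofReal (-(q0 n s))), 0; 0,
          Complex.exp (Complex.ofReal (q0 n s))] *
        Mm z *
        !![Complex.exp (q n s z), 0; 0, Complex.exp (-(q n s z))])
    (s0 : ℝ) (hs0 : 0 < s0)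
    (Kc : Set ℂ) (hKc : IsCompact Kc) (hKcS : Kc ⊆ S) :
    ∃ C > 0, ∃ n0 : ℕ, 1 ≤ n0 ∧
      ∀ n : ℕ, n0 ≤ n → ∀ s : ℝ, -s0 ≤ s → ∀ z ∈ Kc, ∀ i j : Fin 2,
        norm
          ((Mm z * (G n s z)⁻¹ - 1 -
              Complex.ofReal ((n : ℝ) ^ (-(1 : ℝ) / 3)) •
                (Complex.ofReal (q01 s) • σ3 -
                  (Complex.ofReal (q01 s) / (mq z) ^ 2) • (Mm z * σ3 * (Mm z)⁻¹))) i j)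
          ≤ C * (n : ℝ) ^ (-(2 : ℝ) / 3) := by
  obtain ⟨A, hA, c, hc, hct, hQ⟩ := Q_bounds a t ha ht Q hQcont hQpos hQ0 hQsm hQder
  obtain ⟨δ, hδ, hdist⟩ := dist_lem a S hS Kc hKc hKcS
  have hrm := r_eq a ha S hS r hr_an hr_sq hr_pos mq hmq_an hmq_pow hmq_pos
  obtain ⟨Br, hBr⟩ := hKc.exists_bound_of_continuousOn (hr_an.continuousOn.mono hKcS)
  obtain ⟨Bm, hBm⟩ := hKc.exists_bound_of_continuousOn (hmq_an.continuousOn.mono hKcS)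
  obtain ⟨Bi, hBi⟩ := hKc.exists_bound_of_continuousOn
    ((hmq_an.continuousOn.mono hKcS).inv₀ (fun z hz => (hrm z (hKcS hz)).1))
  set B1 : ℝ := 1 + 1 / δ + 1 / δ ^ 2 with hB1
  obtain ⟨C1, hC1, hint⟩ := main_int a t c A s0 B1 ha ht hc hct hA (by positivity) Q hQcont hQ
  obtain ⟨CF, hCF, hFb⟩ := F_bd s0
  set κ : ℝ := 2 * Real.pi * Real.sqrt a * Real.sqrt t with hκ
  have hκp : 0 < κ := by positivity
  have hq01b : ∀ s, -s0 ≤ s → |q01 s| ≤ CF / κ := by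
    intro s hs
    rw [hq01, hF, abs_div, abs_of_pos hκp]
    gcongr
    exact hFb s hs
  set Cp : ℝ := (2 * Real.pi)⁻¹ * C1 with hCp
  have hCpp : 0 < Cp := by positivity
  set B : ℝ := Cp * (1 + |Br|) + (CF / κ) * (1 + |Bi| ^ 2) + (|Bm| ^ 2 + |Bi| ^ 2) with hB
  have hBp : 0 < B := by positivity
  obtain ⟨C, hC, hscal⟩ := scal B hBp
  refine ⟨C, hC, 1, le_refl _, ?_⟩
  intro n hn s hs z hz i j
  have hn0 : (0:ℝ) < n := by exact_mod_cast hn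
  have hn1 : (1:ℝ) ≤ n := by exact_mod_cast hn
  set N : ℝ := (n:ℝ) ^ ((2:ℝ)/3) with hN
  have hNp : 0 < N := by positivity
  set ε : ℝ := (n:ℝ) ^ (-(1:ℝ)/3) with hε
  have hεp : 0 < ε := by positivity
  have hε1 : ε ≤ 1 := Real.rpow_le_one_of_one_le_of_nonpos hn1 (by norm_num)
  have hNh : N ^ (-(1:ℝ)/2) = ε := by
    rw [hN, hε, ← Real.rpow_mul hn0.le]; norm_num
  have hNi : N⁻¹ = ε ^ 2 := by
    rw [hN, hε, ← Real.rpow_neg hn0.le, ← Real.rpow_natCast, ← Real.rpow_mul hn0.le]; norm_num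
  have hn23 : (n:ℝ) ^ (-(2:ℝ)/3) = ε ^ 2 := by
    rw [← hNi, hN, ← Real.rpow_neg hn0.le]; norm_num
  rw [hn23]
  have hεε : ε ^ 2 ≤ ε := by nlinarith
  -- common quantity
  set X : ℝ := ε * F (-(1:ℝ)/2) s / (Real.sqrt a * Real.sqrt t) with hX
  have hXq : (2 * Real.pi)⁻¹ * X = ε * q01 s := by
    rw [hX, hq01, hκ]; field_simp
  -- estimate for q0
  have hp1 : ‖((q0 n s : ℝ) : ℂ) - ((ε * q01 s : ℝ) : ℂ)‖ ≤ Cp * ε ^ 2 := by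
    have h := hint N s (fun _ => 1) 1 hNp hs continuousOn_const (by
        rw [norm_one, hB1]
        have : 0 ≤ 1 / δ + 1 / δ ^ 2 := by positivity
        linarith) (by
        intro x hx
        have h1 : 0 ≤ 1 / δ + 1 / δ ^ 2 := by positivity
        have h2 : 0 ≤ -x := by linarith [hx.2]
        refine ⟨by rw [norm_one]; linarith, ?_⟩
        rw [sub_self, norm_zero]
        positivity)
    rw [hNh, hNi, ← hF, ← hX] at h
    simp only [mul_one] at h
    rw [integral_complex_ofReal, ← Complex.ofReal_add, Complex.norm_real, Real.norm_eq_abs] at h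
    rw [← Complex.ofReal_sub, Complex.norm_real, Real.norm_eq_abs, ← hXq, hq0, ← hN]
    have e : ∀ I : ℝ, -(2 * Real.pi)⁻¹ * I - (2 * Real.pi)⁻¹ * X = -((2 * Real.pi)⁻¹ * (I + X)) := by
      intro I; ring
    rw [e, abs_neg, abs_mul, abs_of_pos (show 0 < (2 * Real.pi)⁻¹ by positivity), hCp, mul_assoc]
    gcongr
  -- estimate for q
  have hzS := hKcS hz
  obtain ⟨hm0, hrz⟩ := hrm z hzS
  have hz0 : δ ≤ ‖z‖ := by
    have := hdist z hz 0 ⟨by linarith, le_refl _⟩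
    simpa using this
  have hzne : z ≠ 0 := by
    intro h; rw [h, norm_zero] at hz0; linarith
  have hq1 : ‖q n s z - ((ε * q01 s : ℝ) : ℂ) / (mq z) ^ 2‖ ≤ Cp * |Br| * ε ^ 2 := by
    have hne : ∀ x ∈ Set.Ioo (-a) (0:ℝ), (x:ℂ) - z ≠ 0 := by
      intro x hx h
      have := hdist z hz x ⟨hx.1.le, hx.2.le⟩
      rw [h, norm_zero] at this; linarith
    have h := hint N s (fun x => ((x:ℂ) - z)⁻¹) (-z⁻¹) hNp hs
      (ContinuousOn.inv₀ (by fun_prop) hne) (by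
        rw [norm_neg, norm_inv, hB1]
        have : ‖z‖⁻¹ ≤ 1 / δ := by rw [one_div]; gcongr
        have : 0 ≤ 1 / δ ^ 2 := by positivity
        linarith) (by
        intro x hx
        have hd := hdist z hz x ⟨hx.1.le, hx.2.le⟩
        have h2 : 0 ≤ -x := by linarith [hx.2]
        constructor
        · rw [norm_inv, hB1]
          have : ‖(x:ℂ) - z‖⁻¹ ≤ 1 / δ := by rw [one_div]; gcongr
          have : 0 ≤ 1 / δ ^ 2 := by positivity
          linarith
        · have e : ((x:ℂ) - z)⁻¹ - -z⁻¹ = ((x:ℂ) - z)⁻¹ * z⁻¹ * x := by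
            have := hne x hx
            field_simp; ring
          rw [e, norm_mul, norm_mul, norm_inv, norm_inv, Complex.norm_real, Real.norm_eq_abs, abs_of_neg hx.2]
          have e2 : ‖(x:ℂ) - z‖⁻¹ * ‖z‖⁻¹ ≤ B1 := by
            calc _ ≤ δ⁻¹ * δ⁻¹ := by gcongr
              _ = 1 / δ ^ 2 := by field_simp
              _ ≤ B1 := by
                rw [hB1]
                have : 0 ≤ 1 / δ := by positivity
                linarith
          gcongr)
    rw [hNh, hNi, ← hF, ← hX] at h
    have e1 : q n s z - ((ε * q01 s : ℝ) : ℂ) / (mq z) ^ 2 = r z * (((2 * Real.pi)⁻¹ : ℝ) : ℂ) *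
        ((∫ x in Set.Ioo (-a) (0 : ℝ), ((Real.log ((1 + Real.exp (-s - N * Q x))⁻¹) /
          Real.sqrt (|x| * (x + a)) : ℝ) : ℂ) * ((x:ℂ) - z)⁻¹) + (X : ℂ) * (-z⁻¹)) := by
      rw [hq, ← hXq, ← hN]
      simp only [div_eq_mul_inv (Complex.ofReal _) ((_ : ℂ) - z)]
      have : ((mq z) ^ 2)⁻¹ = r z * z⁻¹ := by
        rw [← one_div, ← hrz, div_eq_mul_inv]
      rw [div_eq_mul_inv _ ((mq z) ^ 2), this]
      push_cast
      ring
    rw [e1, norm_mul, norm_mul, Complex.norm_real, Real.norm_of_nonneg (show 0 ≤ (2 * Real.pi)⁻¹ by positivity)]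
    calc _ ≤ |Br| * (2 * Real.pi)⁻¹ * (C1 * ε ^ 2) := by
          gcongr
          exact (hBr z hz).trans (le_abs_self _)
      _ = _ := by rw [hCp]; ring
  have hmb : ‖mq z‖ ≤ |Bm| := (hBm z hz).trans (le_abs_self _)
  have hib : ‖(mq z)⁻¹‖ ≤ |Bi| := (hBi z hz).trans (le_abs_self _)
  have hq01s := hq01b s hs
  have hp'b : ‖((ε * q01 s : ℝ) : ℂ)‖ ≤ (CF / κ) * ε := by
    rw [Complex.norm_real, norm_mul, Real.norm_of_nonneg hεp.le, Real.norm_eq_abs, mul_comm]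
    gcongr
  have hq'b : ‖((ε * q01 s : ℝ) : ℂ) / (mq z) ^ 2‖ ≤ (CF / κ) * ε * |Bi| ^ 2 := by
    rw [div_eq_mul_inv, ← inv_pow, norm_mul, norm_pow]
    gcongr
  have n1 : 0 ≤ Cp * |Br| := by positivity
  have n2 : 0 ≤ CF / κ := by positivity
  have n3 : 0 ≤ (CF / κ) * |Bi| ^ 2 := by positivity
  have n4 : 0 ≤ |Bm| ^ 2 + |Bi| ^ 2 := by positivity
  have B_a : Cp ≤ B := by rw [hB]; linarith
  have B_b : Cp * |Br| ≤ B := by rw [hB]; linarith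
  have B_c : Cp + CF / κ ≤ B := by rw [hB]; linarith
  have B_d : Cp * |Br| + (CF / κ) * |Bi| ^ 2 ≤ B := by rw [hB]; linarith
  have B_e : |Bm| ^ 2 + |Bi| ^ 2 ≤ B := by
    rw [hB]
    have : 0 ≤ Cp * (1 + |Br|) + (CF / κ) * (1 + |Bi| ^ 2) := by positivity
    linarith
  have hpB : ‖((q0 n s : ℝ) : ℂ)‖ ≤ B * ε := by
    have h1 := norm_le_norm_add_norm_sub ((ε * q01 s : ℝ) : ℂ) ((q0 n s : ℝ) : ℂ)
    rw [norm_sub_rev] at h1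
    calc _ ≤ (CF / κ) * ε + Cp * ε ^ 2 := by linarith
      _ ≤ (CF / κ) * ε + Cp * ε := by gcongr
      _ = (Cp + CF / κ) * ε := by ring
      _ ≤ _ := by gcongr
  have hqB : ‖q n s z‖ ≤ B * ε := by
    have h1 := norm_le_norm_add_norm_sub (((ε * q01 s : ℝ) : ℂ) / (mq z) ^ 2) (q n s z)
    rw [norm_sub_rev] at h1
    calc _ ≤ (CF / κ) * ε * |Bi| ^ 2 + Cp * |Br| * ε ^ 2 := by linarith
      _ ≤ (CF / κ) * ε * |Bi| ^ 2 + Cp * |Br| * ε := by gcongr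
      _ = (Cp * |Br| + (CF / κ) * |Bi| ^ 2) * ε := by ring
      _ ≤ _ := by gcongr
  have hqq : ‖q n s z - ((ε * q01 s : ℝ) : ℂ) / (mq z) ^ 2‖ ≤ B * ε ^ 2 := hq1.trans (by gcongr)
  have hpp : ‖((q0 n s : ℝ) : ℂ) - ((ε * q01 s : ℝ) : ℂ)‖ ≤ B * ε ^ 2 := hp1.trans (by gcongr)
  have hpp' : ‖-((q0 n s : ℝ) : ℂ) - -((ε * q01 s : ℝ) : ℂ)‖ ≤ B * ε ^ 2 := by
    rw [← norm_neg]; refine le_trans (le_of_eq ?_) hpp; congr 1; ring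
  have hpB' : ‖-((q0 n s : ℝ) : ℂ)‖ ≤ B * ε := by rwa [norm_neg]
  obtain ⟨hPb, hMG⟩ := mat_lem (mq z) (q n s z) ((q0 n s : ℝ) : ℂ) hm0 σ3 U0 (Mm z) hσ3 hU0 (hMm z)
  have hPB : ∀ i j, ‖(Mm z * σ3 * (Mm z)⁻¹) i j‖ ≤ B := fun i j =>
    (hPb i j).trans (le_trans (by gcongr) B_e)
  rw [hG, Complex.ofReal_neg, hMG]
  set P := Mm z * σ3 * (Mm z)⁻¹ with hP
  have d1 : ‖(1:ℂ)‖ ≤ 1 := by simp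
  have d0 : ‖(0:ℂ)‖ ≤ 1 := by simp
  fin_cases j
  · have hh := fun d hd => hscal ε (q n s z) _ ((q0 n s : ℝ) : ℂ) _ (P i 0) d hεp.le hε1 (hPB i 0) hd hqB hpB hqq hpp
    fin_cases i
    · refine le_trans (le_of_eq ?_) (hh 1 d1)
      congr 1
      simp [Matrix.mul_apply, Fin.sum_univ_two, hσ3]
      ring
    · refine le_trans (le_of_eq ?_) (hh 0 d0)
      congr 1
      simp [Matrix.mul_apply, Fin.sum_univ_two, hσ3]
      ring
  · have hh := fun d hd => hscal ε (q n s z) _ (-((q0 n s : ℝ) : ℂ)) _ (P i 1) d hεp.le hε1 (hPB i 1) hd hqB hpB' hqq hpp'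
    fin_cases i
    · refine le_trans (le_of_eq ?_) (hh 0 d0)
      congr 1
      simp [Matrix.mul_apply, Fin.sum_univ_two, hσ3]
      ring
    · refine le_trans (le_of_eq ?_) (hh 1 d1)
      congr 1
      simp [Matrix.mul_apply, Fin.sum_univ_two, hσ3]
      ring
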